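/- Let {A_k}_{k=1}^∞ ⊆ F be pairwise disjoint. Then there exist sets A_k′ ∈ F (k ∈ ℕ) such that: (1) A_k′ ⊆ A_k and A_k ∖ A_k′ ∈ N for each k; (2) A := ⋃_{k=1}^∞ A_k′ ∈ F with ν(A) = ∑_{k=1}^∞ ν(A_k′); (3) ν_N(A_k′) ≤ ν(A_k′) for all k, N ∈ ℕ, and ν_N(A) ≤ ν(A) for all N ∈ ℕ; (4) if {A_k″}_{k=1}^∞ ⊆ F is any family with A_k △ A_k″ ∈ N for each k, ⋃_{k=1}^∞ A_k″ ∈ F, and ν(⋃_{k=1}^∞ A_k″) = ∑_{k=1}^∞ ν(A_k″), then (⋃_{k=1}^∞ A_k′) △ (⋃_{k=1}^∞ A_k″) ∈ N. -/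

import Mathlib

/-- The partial average `ν_N(A) = (1/N)·∑_{n=1}^N 1_A(n)`. -/
noncomputable def nuN (A : Set ℕ) (N : ℕ) : ℝ :=
  (∑ n ∈ Finset.Icc 1 N, A.indicator (fun _ => (1 : ℝ)) n) / N

/-- The upper Cesàro limit `ν⁺(A)`. -/
noncomputable def nuPlus (A : Set ℕ) : ℝ :=
  Filter.limsup (fun N => nuN A N) Filter.atTop

/-- The lower Cesàro limit `ν⁻(A)`. -/
noncomputable def nuMinus (A : Set ℕ) : ℝ :=
  Filter.liminf (fun N => nuN A N) Filter.atTop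

/-- `A ∈ F`: the Cesàro limit of `A` exists. -/
def memF (A : Set ℕ) : Prop :=
  ∃ l : ℝ, Filter.Tendsto (fun N => nuN A N) Filter.atTop (nhds l)

/-- The Cesàro limit `ν(A)`; it coincides with `ν⁺(A)` whenever `A ∈ F`. -/
noncomputable def nu (A : Set ℕ) : ℝ := nuPlus A

/-- `A ∈ N`: `A` is a null set. -/
def nullSet (A : Set ℕ) : Prop := memF A ∧ nu A = 0

open Filter Finset Topology

theorem nuN_nonneg (A : Set ℕ) (N : ℕ) : 0 ≤ nuN A N :=
  div_nonneg (sum_nonneg fun _ _ => Set.indicator_nonneg (fun _ _ => zero_le_one) _) N.cast_nonneg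

theorem sum_indicator_le (A : Set ℕ) (N : ℕ) :
    ∑ n ∈ Icc 1 N, A.indicator (fun _ => (1 : ℝ)) n ≤ N := by
  calc ∑ n ∈ Icc 1 N, A.indicator (fun _ => (1 : ℝ)) n ≤ ∑ _n ∈ Icc 1 N, (1 : ℝ) :=
        sum_le_sum fun n _ => Set.indicator_le_self' (fun _ _ => zero_le_one) n
    _ = N := by simp

theorem nuN_le_one (A : Set ℕ) (N : ℕ) : nuN A N ≤ 1 :=
  div_le_one_of_le₀ (sum_indicator_le A N) N.cast_nonneg

theorem nuN_mono {A B : Set ℕ} (h : A ⊆ B) (N : ℕ) : nuN A N ≤ nuN B N := by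
  unfold nuN
  gcongr with n _

theorem nuN_union_le (A B : Set ℕ) (N : ℕ) : nuN (A ∪ B) N ≤ nuN A N + nuN B N := by
  unfold nuN
  rw [← add_div, ← sum_add_distrib]
  gcongr with n _
  by_cases hA : n ∈ A <;> by_cases hB : n ∈ B <;> simp [hA, hB]

theorem nuN_diff {A B : Set ℕ} (h : B ⊆ A) (N : ℕ) : nuN (A \ B) N = nuN A N - nuN B N := by
  unfold nuN
  rw [← sub_div, ← sum_sub_distrib]
  congr 1
  refine sum_congr rfl fun n _ => ?_
  by_cases hB : n ∈ B
  · simp [hB, h hB]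
  · by_cases hA : n ∈ A <;> simp [hA, hB]

theorem abs_nuN_sub_le (A B : Set ℕ) (N : ℕ) :
    |nuN A N - nuN B N| ≤ nuN (symmDiff A B) N := by
  have h₁ : nuN A N ≤ nuN (symmDiff A B) N + nuN B N :=
    (nuN_mono (fun n hn => by
      by_cases hB : n ∈ B <;> simp [Set.mem_symmDiff, hn, hB]) N).trans (nuN_union_le _ _ N)
  have h₂ : nuN B N ≤ nuN (symmDiff A B) N + nuN A N :=
    (nuN_mono (fun n hn => by
      by_cases hA : n ∈ A <;> simp [Set.mem_symmDiff, hn, hA]) N).trans (nuN_union_le _ _ N)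
  exact abs_sub_le_iff.2 ⟨by linarith, by linarith⟩

theorem nu_eq_of_tendsto {A : Set ℕ} {l : ℝ} (h : Tendsto (nuN A) atTop (𝓝 l)) : nu A = l :=
  h.limsup_eq

theorem memF.tendsto {A : Set ℕ} (h : memF A) : Tendsto (nuN A) atTop (𝓝 (nu A)) := by
  obtain ⟨l, hl⟩ := h
  rwa [nu_eq_of_tendsto hl]

theorem memF.nu_nonneg {A : Set ℕ} (h : memF A) : 0 ≤ nu A :=
  ge_of_tendsto' h.tendsto (nuN_nonneg A)

theorem nullSet_iff_tendsto {A : Set ℕ} : nullSet A ↔ Tendsto (nuN A) atTop (𝓝 0) :=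
  ⟨fun h => h.2 ▸ h.1.tendsto, fun h => ⟨⟨0, h⟩, nu_eq_of_tendsto h⟩⟩

theorem nullSet.mono {A B : Set ℕ} (hB : nullSet B) (h : A ⊆ B) : nullSet A :=
  nullSet_iff_tendsto.2 <|
    squeeze_zero (nuN_nonneg A) (nuN_mono h) (nullSet_iff_tendsto.1 hB)

theorem nullSet.union {A B : Set ℕ} (hA : nullSet A) (hB : nullSet B) : nullSet (A ∪ B) :=
  nullSet_iff_tendsto.2 <|
    squeeze_zero (nuN_nonneg _) (nuN_union_le A B)
      (by simpa using (nullSet_iff_tendsto.1 hA).add (nullSet_iff_tendsto.1 hB))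

theorem tendsto_of_nullSet_symmDiff {A B : Set ℕ} {l : ℝ} (hA : Tendsto (nuN A) atTop (𝓝 l))
    (h : nullSet (symmDiff A B)) : Tendsto (nuN B) atTop (𝓝 l) := by
  have hsub : Tendsto (fun N => nuN A N - nuN B N) atTop (𝓝 0) :=
    squeeze_zero_norm (abs_nuN_sub_le A B) (nullSet_iff_tendsto.1 h)
  simpa using hA.sub hsub

theorem hasSum_nuN_iUnion {A : ℕ → Set ℕ} (hA : Pairwise (Function.onFun Disjoint A)) (N : ℕ) :
    HasSum (fun k => nuN (A k) N) (nuN (⋃ k, A k) N) := by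
  refine HasSum.div_const (hasSum_sum fun n _ => ?_) _
  by_cases hn : ∃ k, n ∈ A k
  · obtain ⟨k, hk⟩ := hn
    have h : (⋃ k, A k).indicator (fun _ => (1 : ℝ)) n = (A k).indicator (fun _ => 1) n := by
      rw [Set.indicator_of_mem hk, Set.indicator_of_mem (Set.mem_iUnion_of_mem k hk)]
    rw [h]
    exact hasSum_single k fun j hj =>
      Set.indicator_of_notMem (fun hnj => Set.disjoint_left.1 (hA hj) hnj hk) _
  · rw [Set.indicator_of_notMem (by simpa using hn)]
    convert hasSum_zero with k
    exact Set.indicator_of_notMem (fun hk => hn ⟨k, hk⟩) _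

theorem sum_nuN_le_nuN_iUnion {A : ℕ → Set ℕ} (hA : Pairwise (Function.onFun Disjoint A))
    (K N : ℕ) : ∑ k ∈ range K, nuN (A k) N ≤ nuN (⋃ k, A k) N :=
  sum_le_hasSum _ (fun k _ => nuN_nonneg (A k) N) (hasSum_nuN_iUnion hA N)

theorem summable_nu {A : ℕ → Set ℕ} (hA : Pairwise (Function.onFun Disjoint A))
    (hF : ∀ k, memF (A k)) : Summable fun k => nu (A k) :=
  summable_of_sum_range_le (fun k => (hF k).nu_nonneg) fun K =>
    le_of_tendsto' (tendsto_finsetSum _ fun k _ => (hF k).tendsto) fun N =>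
      (sum_nuN_le_nuN_iUnion hA K N).trans (nuN_le_one _ N)

theorem nuN_iUnion_le_tsum {A : ℕ → Set ℕ} (hA : Pairwise (Function.onFun Disjoint A))
    (hF : ∀ k, memF (A k)) (hle : ∀ k N, nuN (A k) N ≤ nu (A k)) (N : ℕ) :
    nuN (⋃ k, A k) N ≤ ∑' k, nu (A k) :=
  hasSum_le (fun k => hle k N) (hasSum_nuN_iUnion hA N) (summable_nu hA hF).hasSum

theorem tendsto_nuN_iUnion {A : ℕ → Set ℕ} (hA : Pairwise (Function.onFun Disjoint A))
    (hF : ∀ k, memF (A k)) (hle : ∀ k N, nuN (A k) N ≤ nu (A k)) :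
    Tendsto (nuN (⋃ k, A k)) atTop (𝓝 (∑' k, nu (A k))) := by
  refine tendsto_order.2 ⟨fun b hb => ?_, fun b hb => Eventually.of_forall fun N =>
    (nuN_iUnion_le_tsum hA hF hle N).trans_lt hb⟩
  obtain ⟨K, hK⟩ :=
    ((summable_nu hA hF).hasSum.tendsto_sum_nat.eventually (lt_mem_nhds hb)).exists
  have hlim : Tendsto (fun N => ∑ k ∈ range K, nuN (A k) N) atTop
      (𝓝 (∑ k ∈ range K, nu (A k))) := tendsto_finsetSum _ fun k _ => (hF k).tendsto
  filter_upwards [hlim.eventually (lt_mem_nhds hK)] with N hN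
  exact hN.trans_le (sum_nuN_le_nuN_iUnion hA K N)

theorem nuN_symmDiff_iUnion_le {A B : ℕ → Set ℕ} (hA : Pairwise (Function.onFun Disjoint A))
    (K N : ℕ) :
    nuN (symmDiff (⋃ k, A k) (⋃ k, B k)) N ≤
      nuN (⋃ k, A k) N + nuN (⋃ k, B k) N - 2 * ∑ k ∈ range K, nuN (A k) N
        + 2 * ∑ k ∈ range K, nuN (symmDiff (A k) (B k)) N := by
  simp only [nuN]
  rw [← sum_div, ← sum_div, ← mul_div_assoc, ← mul_div_assoc, ← add_div, ← sub_div, ← add_div]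
  gcongr
  rw [sum_comm, sum_comm (s := range K), mul_sum, mul_sum, ← sum_add_distrib, ← sum_sub_distrib,
    ← sum_add_distrib]
  refine sum_le_sum fun n _ => ?_
  have hnn : ∀ k ∈ range K, 0 ≤ (symmDiff (A k) (B k)).indicator (fun _ => (1 : ℝ)) n :=
    fun k _ => Set.indicator_nonneg (fun _ _ => zero_le_one) _
  have hU : (symmDiff (⋃ k, A k) (⋃ k, B k)).indicator (fun _ => (1 : ℝ)) n ≤
      (⋃ k, A k).indicator (fun _ => (1 : ℝ)) n + (⋃ k, B k).indicator (fun _ => (1 : ℝ)) n := by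
    generalize (⋃ k, A k) = U
    generalize (⋃ k, B k) = V
    by_cases h₁ : n ∈ U <;> by_cases h₂ : n ∈ V <;> simp [h₁, h₂, Set.mem_symmDiff]
  by_cases hn : ∃ k ∈ range K, n ∈ A k
  · obtain ⟨k, hkK, hk⟩ := hn
    have hone : ∑ j ∈ range K, (A j).indicator (fun _ => (1 : ℝ)) n = 1 := by
      rw [sum_eq_single_of_mem k hkK fun j _ hj =>
        Set.indicator_of_notMem (fun hnj => Set.disjoint_left.1 (hA hj) hnj hk) _]
      exact Set.indicator_of_mem hk _
    rw [hone]
    by_cases hB : n ∈ B k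
    · have h₁ : n ∈ ⋃ k, A k := Set.mem_iUnion_of_mem k hk
      have h₂ : n ∈ ⋃ k, B k := Set.mem_iUnion_of_mem k hB
      rw [Set.indicator_of_mem h₁, Set.indicator_of_mem h₂,
        Set.indicator_of_notMem (by simp only [Set.mem_symmDiff]; tauto)]
      linarith [sum_nonneg hnn]
    · have h := single_le_sum hnn hkK
      rw [Set.indicator_of_mem (show n ∈ symmDiff (A k) (B k) from Or.inl ⟨hk, hB⟩)] at h
      linarith
  · rw [sum_eq_zero (f := fun j => (A j).indicator (fun _ => (1 : ℝ)) n) fun j hj =>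
      Set.indicator_of_notMem (fun h => hn ⟨j, hj, h⟩) _]
    linarith [sum_nonneg hnn]

theorem nullSet_symmDiff_iUnion {A B : ℕ → Set ℕ} {s : ℝ}
    (hA : Pairwise (Function.onFun Disjoint A)) (hF : ∀ k, memF (A k))
    (hs : HasSum (fun k => nu (A k)) s) (hU : Tendsto (nuN (⋃ k, A k)) atTop (𝓝 s))
    (hV : Tendsto (nuN (⋃ k, B k)) atTop (𝓝 s)) (hAB : ∀ k, nullSet (symmDiff (A k) (B k))) :
    nullSet (symmDiff (⋃ k, A k) (⋃ k, B k)) := by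
  refine nullSet_iff_tendsto.2 (tendsto_order.2 ⟨fun b hb => Eventually.of_forall fun N =>
    hb.trans_le (nuN_nonneg _ N), fun b hb => ?_⟩)
  obtain ⟨K, hK⟩ := (hs.tendsto_sum_nat.eventually
    (lt_mem_nhds (show s - b / 2 < s by linarith))).exists
  have hlim := ((hU.add hV).sub ((tendsto_finsetSum (range K)
    fun k _ => (hF k).tendsto).const_mul 2)).add ((tendsto_finsetSum (range K)
    fun k _ => nullSet_iff_tendsto.1 (hAB k)).const_mul 2)
  rw [sum_const_zero] at hlim
  filter_upwards [hlim.eventually (gt_mem_nhds (show _ < b by linarith))] with N hN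
  exact (nuN_symmDiff_iUnion_le hA K N).trans_lt hN

open Classical in
/-- The number of elements of `[1, n]` selected from `A` by the greedy rule that accepts an
element of `A` whenever this keeps the partial average at most `a`. -/
noncomputable def greedyCount (A : Set ℕ) (a : ℝ) : ℕ → ℕ
  | 0 => 0
  | n + 1 =>
    if n + 1 ∈ A ∧ (greedyCount A a n : ℝ) + 1 ≤ a * (n + 1 : ℕ) then greedyCount A a n + 1
    else greedyCount A a n

/-- The subset of `A` selected by the greedy rule of `greedyCount`. -/
def greedySet (A : Set ℕ) (a : ℝ) : Set ℕ :=
  {n | ∃ m, n = m + 1 ∧ m + 1 ∈ A ∧ (greedyCount A a m : ℝ) + 1 ≤ a * (m + 1 : ℕ)}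

theorem greedySet_subset (A : Set ℕ) (a : ℝ) : greedySet A a ⊆ A := by
  rintro _ ⟨m, rfl, hm, -⟩
  exact hm

theorem succ_mem_greedySet {A : Set ℕ} {a : ℝ} {n : ℕ} :
    n + 1 ∈ greedySet A a ↔ n + 1 ∈ A ∧ (greedyCount A a n : ℝ) + 1 ≤ a * (n + 1 : ℕ) := by
  simp [greedySet]

theorem sum_indicator_greedySet (A : Set ℕ) (a : ℝ) (N : ℕ) :
    ∑ n ∈ Icc 1 N, (greedySet A a).indicator (fun _ => (1 : ℝ)) n = greedyCount A a N := by
  induction N with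
  | zero => simp [greedyCount]
  | succ N ih =>
    rw [sum_Icc_succ_top (by omega), ih, greedyCount]
    split_ifs with h
    · rw [Set.indicator_of_mem (succ_mem_greedySet.2 h)]
      push_cast
      ring
    · rw [Set.indicator_of_notMem (mt succ_mem_greedySet.1 h), add_zero]

theorem greedyCount_le {a : ℝ} (ha : 0 ≤ a) (A : Set ℕ) (N : ℕ) :
    (greedyCount A a N : ℝ) ≤ a * N := by
  induction N with
  | zero => simp [greedyCount]
  | succ N ih =>
    rw [greedyCount]
    split_ifs with h
    · exact_mod_cast h.2
    · push_cast
      linarith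

theorem nuN_greedySet_le {a : ℝ} (ha : 0 ≤ a) (A : Set ℕ) (N : ℕ) :
    nuN (greedySet A a) N ≤ a := by
  rw [nuN, sum_indicator_greedySet]
  exact div_le_of_le_mul₀ N.cast_nonneg ha (greedyCount_le ha A N)

theorem sum_indicator_le_greedyCount_add {A : Set ℕ} {a ε C : ℝ} (hε : 0 ≤ ε) (hC : 0 ≤ C)
    (h : ∀ N : ℕ, ∑ n ∈ Icc 1 N, A.indicator (fun _ => (1 : ℝ)) n ≤ (a + ε) * N + C) (N : ℕ) :
    ∑ n ∈ Icc 1 N, A.indicator (fun _ => (1 : ℝ)) n ≤ greedyCount A a N + (ε * N + C + 1) := by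
  induction N with
  | zero => simp [greedyCount]; linarith
  | succ N ih =>
    have hN := h (N + 1)
    rw [sum_Icc_succ_top (by omega)] at hN ⊢
    by_cases hA : N + 1 ∈ A
    · rw [Set.indicator_of_mem hA] at hN ⊢
      rw [greedyCount]
      split_ifs with hacc
      · push_cast
        linarith
      · have hlt := not_le.1 fun hle => hacc ⟨hA, hle⟩
        linarith
    · rw [Set.indicator_of_notMem hA, greedyCount, if_neg fun hacc => hA hacc.1]
      push_cast
      linarith

theorem exists_sum_indicator_le {A : Set ℕ} {a ε : ℝ} (ha : 0 ≤ a) (hε : 0 < ε)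
    (hA : Tendsto (nuN A) atTop (𝓝 a)) :
    ∃ C : ℝ, 0 ≤ C ∧
      ∀ N : ℕ, ∑ n ∈ Icc 1 N, A.indicator (fun _ => (1 : ℝ)) n ≤ (a + ε) * N + C := by
  obtain ⟨M, hM⟩ := eventually_atTop.1 (hA.eventually (gt_mem_nhds (lt_add_of_pos_right a hε)))
  refine ⟨M, M.cast_nonneg, fun N => ?_⟩
  have hnn : 0 ≤ (a + ε) * N := by positivity
  rcases le_total N M with hNM | hNM
  · have : (N : ℝ) ≤ M := by exact_mod_cast hNM
    linarith [sum_indicator_le A N]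
  · rcases N.eq_zero_or_pos with rfl | hpos
    · simp
    · have h := (div_lt_iff₀ (Nat.cast_pos.2 hpos)).1 (hM N hNM)
      linarith [M.cast_nonneg (α := ℝ)]

theorem nullSet_diff_greedySet {A : Set ℕ} {a : ℝ} (ha : 0 ≤ a)
    (hA : Tendsto (nuN A) atTop (𝓝 a)) : nullSet (A \ greedySet A a) := by
  refine nullSet_iff_tendsto.2 (tendsto_order.2 ⟨fun b hb => Eventually.of_forall fun N =>
    hb.trans_le (nuN_nonneg _ N), fun b hb => ?_⟩)
  obtain ⟨C, hC, hle⟩ := exists_sum_indicator_le ha (half_pos hb) hA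
  have hlim := tendsto_const_div_atTop_nhds_zero_nat (C + 1)
  filter_upwards [hlim.eventually (gt_mem_nhds (half_pos hb)), eventually_gt_atTop 0] with N hN hpos
  have hpos' : (0 : ℝ) < N := Nat.cast_pos.2 hpos
  rw [nuN_diff (greedySet_subset A a), nuN, nuN, sum_indicator_greedySet, ← sub_div,
    div_lt_iff₀ hpos']
  rw [div_lt_iff₀ hpos'] at hN
  linarith [sum_indicator_le_greedyCount_add (half_pos hb).le hC hle N]

theorem memF.exists_subset_nuN_le {A : Set ℕ} (hA : memF A) :
    ∃ B ⊆ A, nullSet (A \ B) ∧ memF B ∧ ∀ N, nuN B N ≤ nu B := by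
  have hnull := nullSet_diff_greedySet hA.nu_nonneg hA.tendsto
  have hsub := greedySet_subset A (nu A)
  have hlim : Tendsto (nuN (greedySet A (nu A))) atTop (𝓝 (nu A)) :=
    tendsto_of_nullSet_symmDiff hA.tendsto (by rwa [symmDiff_of_ge hsub])
  refine ⟨_, hsub, hnull, ⟨_, hlim⟩, fun N => ?_⟩
  rw [nu_eq_of_tendsto hlim]
  exact nuN_greedySet_le hA.nu_nonneg A N

theorem stmt15 (A : ℕ → Set ℕ) (hF : ∀ k, memF (A k))
    (hdisj : Pairwise (Function.onFun Disjoint A)) :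
    ∃ A' : ℕ → Set ℕ,
      (∀ k, memF (A' k)) ∧
      (∀ k, A' k ⊆ A k ∧ nullSet (A k \ A' k)) ∧
      (memF (⋃ k, A' k) ∧ nu (⋃ k, A' k) = ∑' k, nu (A' k)) ∧
      (∀ k N, nuN (A' k) N ≤ nu (A' k)) ∧
      (∀ N, nuN (⋃ k, A' k) N ≤ nu (⋃ k, A' k)) ∧
      (∀ A'' : ℕ → Set ℕ, (∀ k, memF (A'' k)) →
        (∀ k, nullSet (symmDiff (A k) (A'' k))) →
        memF (⋃ k, A'' k) → nu (⋃ k, A'' k) = ∑' k, nu (A'' k) →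
        nullSet (symmDiff (⋃ k, A' k) (⋃ k, A'' k))) := by
  choose A' hsub hnull hF' hle using fun k => (hF k).exists_subset_nuN_le
  have hdisj' : Pairwise (Function.onFun Disjoint A') := fun i j hij =>
    (hdisj hij).mono (hsub i) (hsub j)
  have hlim := tendsto_nuN_iUnion hdisj' hF' hle
  refine ⟨A', hF', fun k => ⟨hsub k, hnull k⟩, ⟨⟨_, hlim⟩, nu_eq_of_tendsto hlim⟩, hle,
    fun N => ?_, fun A'' _ hnull'' hFU hU => ?_⟩
  · rw [nu_eq_of_tendsto hlim]
    exact nuN_iUnion_le_tsum hdisj' hF' hle N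
  · have hsymm : ∀ k, nullSet (symmDiff (A' k) (A'' k)) := fun k =>
      (((hnull k).union (hnull'' k)).mono (by
        rw [← symmDiff_of_ge (hsub k), symmDiff_comm (A k)]
        exact symmDiff_triangle (A' k) (A k) (A'' k)))
    have hnu : ∀ k, nu (A'' k) = nu (A' k) := fun k =>
      nu_eq_of_tendsto (tendsto_of_nullSet_symmDiff (hF' k).tendsto (hsymm k))
    have hlim'' := hFU.tendsto
    simp only [hU, hnu] at hlim''
    exact nullSet_symmDiff_iUnion hdisj' hF' (summable_nu hdisj' hF').hasSum hlim hlim'' hsymm
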